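/- arXiv:1711.07862 — 8 statements merged into one kernel-verified Lean document; each statement's English description precedes it below -/
import Mathlib

section
/- Let N ≥ 1, let L be the diagonal (N+1)×(N+1) real matrix with diagonal entries λ_0,…,λ_N, and let Z be the symmetric tridiagonal real matrix with diagonal entries η_n and off-diagonal entries Z_{n,n−1} = Z_{n−1,n} = ξ_n (1 ≤ n ≤ N). Fix 0 ≤ J ≤ N−1, assume ξ_{J+1} ≠ 0 and λ_J ≠ λ_{J+1}, and let π_J be the diagonal projection with (π_J)_{ii} = 1 for i ≤ J and 0 otherwise. Then the algebraic Heun operator M = τ_1 LZ + τ_2 ZL + τ_3 L + τ_4 Z + τ_0 I satisfies M π_J = π_J M if and only if τ_2 = τ_1 and τ_1(λ_J + λ_{J+1}) + τ_4 = 0. -/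
/-- The diagonal projection matrix `π_J` with ones on the diagonal for indices `≤ J`. -/
def projMat (N J : ℕ) : Matrix (Fin (N + 1)) (Fin (N + 1)) ℝ :=
  Matrix.of fun i j => if i = j ∧ (i : ℕ) ≤ J then 1 else 0

/-- A matrix commutes with `projMat N J` iff its entries
linking `{0, …, J}` to its complement vanish. -/
lemma mul_projMat_eq_iff {N J : ℕ} (M : Matrix (Fin (N + 1)) (Fin (N + 1)) ℝ) :
    M * projMat N J = projMat N J * M ↔
      ∀ i j : Fin (N + 1), ¬((i : ℕ) ≤ J ↔ (j : ℕ) ≤ J) → M i j = 0 := by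
  have hp : projMat N J =
      Matrix.diagonal fun i : Fin (N + 1) => if (i : ℕ) ≤ J then (1 : ℝ) else 0 := by
    ext i j
    simp only [projMat, Matrix.of_apply, Matrix.diagonal_apply, ite_and]
  rw [hp, ← Matrix.ext_iff]
  refine forall₂_congr fun i j => ?_
  rw [Matrix.mul_diagonal, Matrix.diagonal_mul]
  by_cases hi : (i : ℕ) ≤ J <;> by_cases hj : (j : ℕ) ≤ J <;> simp [hi, hj, eq_comm]

/-- The off-diagonal entries of an algebraic Heun operator built from a diagonal matrix. -/
lemma heun_apply_of_ne {n : Type*} [Fintype n] [DecidableEq n] (d : n → ℝ) (Z : Matrix n n ℝ)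
    (τ0 τ1 τ2 τ3 τ4 : ℝ) {i j : n} (hij : i ≠ j) :
    (τ1 • (Matrix.diagonal d * Z) + τ2 • (Z * Matrix.diagonal d) + τ3 • Matrix.diagonal d +
      τ4 • Z + τ0 • (1 : Matrix n n ℝ)) i j = (τ1 * d i + τ2 * d j + τ4) * Z i j := by
  simp only [Matrix.add_apply, Matrix.smul_apply, Matrix.diagonal_mul, Matrix.mul_diagonal,
    Matrix.diagonal_apply_ne _ hij, Matrix.one_apply_ne hij, smul_eq_mul]
  ring

theorem stmt_3 (N : ℕ) (hN : 1 ≤ N) (lam eta xi : ℕ → ℝ) (τ0 τ1 τ2 τ3 τ4 : ℝ)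
    (J : ℕ) (hJ : J ≤ N - 1) (hxi : xi (J + 1) ≠ 0) (hlam : lam J ≠ lam (J + 1))
    (L Z M : Matrix (Fin (N + 1)) (Fin (N + 1)) ℝ)
    (hL : L = Matrix.of fun i j : Fin (N + 1) => if i = j then lam (i : ℕ) else 0)
    (hZ : Z = Matrix.of fun i j : Fin (N + 1) =>
      if i = j then eta (i : ℕ)
      else if (i : ℕ) = (j : ℕ) + 1 then xi (i : ℕ)
      else if (j : ℕ) = (i : ℕ) + 1 then xi (j : ℕ)
      else 0)
    (hM : M = τ1 • (L * Z) + τ2 • (Z * L) + τ3 • L + τ4 • Z + τ0 • (1 : Matrix _ _ ℝ)) :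
    M * projMat N J = projMat N J * M ↔
      (τ2 = τ1 ∧ τ1 * (lam J + lam (J + 1)) + τ4 = 0) := by
  have hLd : L = Matrix.diagonal fun i : Fin (N + 1) => lam (i : ℕ) := by
    ext i j
    simp only [hL, Matrix.of_apply, Matrix.diagonal_apply]
  have hMij : ∀ i j : Fin (N + 1), i ≠ j →
      M i j = (τ1 * lam i + τ2 * lam j + τ4) * Z i j := fun i j hij => by
    rw [hM, hLd, heun_apply_of_ne _ _ _ _ _ _ _ hij]
  rw [mul_projMat_eq_iff]
  constructor
  · intro h
    let a : Fin (N + 1) := ⟨J, by omega⟩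
    let b : Fin (N + 1) := ⟨J + 1, by omega⟩
    have hab : a ≠ b := by simp [a, b]
    have h1 := h a b (by simp [a, b])
    have h2 := h b a (by simp [a, b])
    rw [hMij _ _ hab] at h1
    rw [hMij _ _ hab.symm] at h2
    have hZab : Z a b = xi (J + 1) := by
      simp [hZ, a, b, show J ≠ J + 1 + 1 by omega]
    have hZba : Z b a = xi (J + 1) := by simp [hZ, a, b]
    rw [hZab] at h1
    rw [hZba] at h2
    have e1 : τ1 * lam J + τ2 * lam (J + 1) + τ4 = 0 := (mul_eq_zero.mp h1).resolve_right hxi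
    have e2 : τ1 * lam (J + 1) + τ2 * lam J + τ4 = 0 := (mul_eq_zero.mp h2).resolve_right hxi
    have hτ : τ2 = τ1 := by
      refine mul_right_cancel₀ (sub_ne_zero.mpr hlam) ?_
      linear_combination e2 - e1
    refine ⟨hτ, ?_⟩
    rw [hτ] at e1
    linear_combination e1
  · rintro ⟨rfl, h⟩ i j hij
    have hne : i ≠ j := by
      rintro rfl
      exact hij Iff.rfl
    rw [hMij i j hne, hZ, Matrix.of_apply, if_neg hne]
    split_ifs with h1 h2
    · have hi : (i : ℕ) = J + 1 := by omega
      have hj : (j : ℕ) = J := by omega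
      rw [hi, hj]
      linear_combination xi (J + 1) * h
    · have hi : (i : ℕ) = J := by omega
      have hj : (j : ℕ) = J + 1 := by omega
      rw [hi, hj]
      linear_combination xi (J + 1) * h
    · exact mul_zero _
end

section
/- Let α be a real number, let A : ℝ → ℝ be twice continuously differentiable, B : ℝ → ℝ continuously differentiable and C : ℝ → ℝ continuous, and suppose A(α) = 0 and B(α) = A'(α). Then for all twice continuously differentiable compactly supported f, g : ℝ → ℝ, ∫_{(-∞, α]} ((Mf)(x) g(x) − f(x) (M†g)(x)) dx = 0, where (Mf)(x) = A(x) f''(x) + B(x) f'(x) + C(x) f(x) and (M†g)(x) = (A g)''(x) − (B g)'(x) + C(x) g(x). (This expresses that M commutes with multiplication by the characteristic function of the half-line (−∞, α].) -/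
/-- The bilinear concomitant of `A ∂² + B ∂ + C` at `f`, `g`, written with `u = A g`, `v = B g`. -/
theorem deriv_concomitant {f u v : ℝ → ℝ} (hf : ContDiff ℝ 2 f) (hu : ContDiff ℝ 2 u)
    (hv : ContDiff ℝ 1 v) (x : ℝ) :
    deriv (fun y => deriv f y * u y - f y * deriv u y + f y * v y) x =
      deriv (deriv f) x * u x - f x * deriv (deriv u) x + (deriv f x * v x + f x * deriv v x) := by
  have hf0 := (hf.differentiable (by norm_num) x).hasDerivAt
  have hu0 := (hu.differentiable (by norm_num) x).hasDerivAt
  have hv0 := (hv.differentiable (by norm_num) x).hasDerivAt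
  have hf1 := (hf.differentiable_deriv_two x).hasDerivAt
  have hu1 := (hu.differentiable_deriv_two x).hasDerivAt
  have h := (((hf1.mul hu0).sub (hf0.mul hu1)).add (hf0.mul hv0)).deriv
  refine h.trans ?_
  ring

theorem stmt_7 (α : ℝ) (A B C : ℝ → ℝ)
    (hA : ContDiff ℝ 2 A) (hB : ContDiff ℝ 1 B) (hC : Continuous C)
    (hAα : A α = 0) (hBα : B α = deriv A α)
    (f g : ℝ → ℝ) (hf : ContDiff ℝ 2 f) (hg : ContDiff ℝ 2 g)
    (hfc : HasCompactSupport f) (hgc : HasCompactSupport g) :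
    (∫ x in Set.Iic α,
      ((A x * deriv (deriv f) x + B x * deriv f x + C x * f x) * g x -
        f x * (deriv (deriv (fun y => A y * g y)) x - deriv (fun y => B y * g y) x +
          C x * g x))) = 0 := by
  have hu : ContDiff ℝ 2 (fun y => A y * g y) := hA.mul hg
  have hv : ContDiff ℝ 1 (fun y => B y * g y) := hB.mul (hg.of_le (by norm_num))
  set W : ℝ → ℝ := fun y => deriv f y * (A y * g y) - f y * deriv (fun y => A y * g y) y
    + f y * (B y * g y) with hW
  have hf1 : ContDiff ℝ 1 f := hf.of_le (by norm_num)
  have hd1 {h : ℝ → ℝ} (hh : ContDiff ℝ 2 h) : ContDiff ℝ 1 (deriv h) :=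
    ContDiff.deriv' (hh.of_le (by norm_num))
  have hWs : ContDiff ℝ 1 W :=
    ((hd1 hf).mul (hu.of_le (by norm_num)) |>.sub (hf1.mul (hd1 hu))).add (hf1.mul hv)
  have hWc : HasCompactSupport W :=
    ((hfc.deriv.mul_right).sub hfc.mul_right).add hfc.mul_right
  have hWα : W α = 0 := by
    have hd : deriv (fun y => A y * g y) α = deriv A α * g α + A α * deriv g α :=
      ((hA.differentiable (by norm_num) α).hasDerivAt.mul
        (hg.differentiable (by norm_num) α).hasDerivAt).deriv
    simp only [hW, hd, hAα, hBα]
    ring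
  rw [← hWα, ← hWc.integral_Iic_deriv_eq hWs α]
  congr 1 with x
  rw [hW, deriv_concomitant hf hu hv]
  ring
end

section
/- Let a, b : ℝ → ℝ with a continuously differentiable, let φ : ℝ → ℝ be twice continuously differentiable, let τ_1, τ_2, τ_3 be real numbers, and let α ∈ ℝ satisfy a(α) ≠ 0 and φ'(α) ≠ 0. Define A(x) = a(x)((τ_1 + τ_2) φ(x) + τ_3) and B(x) = 2 τ_1 a(x) φ'(x) + b(x)((τ_1 + τ_2) φ(x) + τ_3) (the second- and first-order coefficients of the algebraic Heun operator M = τ_1 LZ + τ_2 ZL + τ_3 L + τ_4 Z built from (Lf) = a f'' + b f' + c f and multiplication Z by φ). Then A(α) = 0 and B(α) = A'(α) hold if and only if τ_2 = τ_1 and τ_3 + 2 τ_1 φ(α) = 0. (Hence M commutes with the projection onto the half-line (−∞, α] precisely under these conditions.) -/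
theorem stmt_9 (a b φ : ℝ → ℝ)
    (ha : ContDiff ℝ 1 a) (hφ : ContDiff ℝ 2 φ)
    (τ1 τ2 τ3 : ℝ) (α : ℝ) (haα : a α ≠ 0) (hφα : deriv φ α ≠ 0)
    (A B : ℝ → ℝ)
    (hA : A = fun x => a x * ((τ1 + τ2) * φ x + τ3))
    (hB : B = fun x => 2 * τ1 * a x * deriv φ x + b x * ((τ1 + τ2) * φ x + τ3)) :
    (A α = 0 ∧ B α = deriv A α) ↔ (τ2 = τ1 ∧ τ3 + 2 * τ1 * φ α = 0) := by
  have hda : HasDerivAt a (deriv a α) α := (ha.differentiable (by norm_num) α).hasDerivAt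
  have hdφ : HasDerivAt φ (deriv φ α) α := (hφ.differentiable (by norm_num) α).hasDerivAt
  have hdA : deriv A α =
      deriv a α * ((τ1 + τ2) * φ α + τ3) + a α * ((τ1 + τ2) * deriv φ α) := by
    rw [hA]
    exact (hda.mul ((hdφ.const_mul (τ1 + τ2)).add_const τ3)).deriv
  rw [hdA, hA, hB]
  constructor
  · rintro ⟨h0, h1⟩
    have hw : (τ1 + τ2) * φ α + τ3 = 0 := (mul_eq_zero.mp h0).resolve_left haα
    have hτ : τ2 = τ1 := by
      apply mul_left_cancel₀ (mul_ne_zero haα hφα)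
      simp only [hw] at h1
      linear_combination -h1
    refine ⟨hτ, ?_⟩
    rw [hτ] at hw
    linear_combination hw
  · rintro ⟨rfl, h⟩
    have hw : (τ2 + τ2) * φ α + τ3 = 0 := by linear_combination h
    simp only [hw]
    exact ⟨by ring, by ring⟩
end

section
/- Let a, b : ℝ → ℝ with a continuously differentiable, let φ : ℝ → ℝ be twice continuously differentiable, let τ_1, τ_2, τ_3 be real numbers with (τ_1, τ_2) ≠ (0, 0), and let α < β be real numbers with a(α) ≠ 0, a(β) ≠ 0, φ'(α) ≠ 0 and φ'(β) ≠ 0. Define A(x) = a(x)((τ_1 + τ_2) φ(x) + τ_3) and B(x) = 2 τ_1 a(x) φ'(x) + b(x)((τ_1 + τ_2) φ(x) + τ_3). Then the four conditions A(α) = 0, B(α) = A'(α), A(β) = 0, B(β) = A'(β) hold if and only if τ_2 = τ_1, τ_3 + 2 τ_1 φ(α) = 0, and φ(β) = φ(α). (Hence the algebraic Heun operator M = τ_1 LZ + τ_2 ZL + τ_3 L + τ_4 Z commutes with the projection onto the interval [α, β] precisely under these conditions.) -/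
/-- At a point where `a` and `φ'` do not vanish, the two boundary conditions on the algebraic Heun
operator amount to equality of the two bilinear parameters and one affine condition on `φ`. -/
theorem heun_boundary_iff {a φ : ℝ → ℝ} {x : ℝ} (ha : DifferentiableAt ℝ a x)
    (hφ : DifferentiableAt ℝ φ x) (hax : a x ≠ 0) (hφx : deriv φ x ≠ 0) (b : ℝ → ℝ)
    (τ1 τ2 τ3 : ℝ) :
    (a x * ((τ1 + τ2) * φ x + τ3) = 0 ∧
      2 * τ1 * a x * deriv φ x + b x * ((τ1 + τ2) * φ x + τ3) =
        deriv (fun y => a y * ((τ1 + τ2) * φ y + τ3)) x) ↔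
      (τ2 = τ1 ∧ τ3 + 2 * τ1 * φ x = 0) := by
  have hderiv : deriv (fun y => a y * ((τ1 + τ2) * φ y + τ3)) x =
      deriv a x * ((τ1 + τ2) * φ x + τ3) + a x * ((τ1 + τ2) * deriv φ x) :=
    (ha.hasDerivAt.mul ((hφ.hasDerivAt.const_mul (τ1 + τ2)).add_const τ3)).deriv
  rw [hderiv]
  constructor
  · rintro ⟨h0, h1⟩
    have hz : (τ1 + τ2) * φ x + τ3 = 0 := (mul_eq_zero.mp h0).resolve_left hax
    rw [hz] at h1
    have hτ : τ2 = τ1 :=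
      mul_right_cancel₀ (mul_ne_zero hax hφx) (by linear_combination -h1)
    subst hτ
    exact ⟨rfl, by linear_combination hz⟩
  · rintro ⟨rfl, h⟩
    have hz : (τ2 + τ2) * φ x + τ3 = 0 := by linear_combination h
    rw [hz]
    exact ⟨by ring, by ring⟩

theorem stmt_10 (a b φ : ℝ → ℝ)
    (ha : ContDiff ℝ 1 a) (hφ : ContDiff ℝ 2 φ)
    (τ1 τ2 τ3 : ℝ) (hτ : ¬(τ1 = 0 ∧ τ2 = 0))
    (α β : ℝ) (hαβ : α < β)
    (haα : a α ≠ 0) (haβ : a β ≠ 0) (hφα : deriv φ α ≠ 0) (hφβ : deriv φ β ≠ 0)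
    (A B : ℝ → ℝ)
    (hA : A = fun x => a x * ((τ1 + τ2) * φ x + τ3))
    (hB : B = fun x => 2 * τ1 * a x * deriv φ x + b x * ((τ1 + τ2) * φ x + τ3)) :
    (A α = 0 ∧ B α = deriv A α ∧ A β = 0 ∧ B β = deriv A β) ↔
      (τ2 = τ1 ∧ τ3 + 2 * τ1 * φ α = 0 ∧ φ β = φ α) := by
  have hda : Differentiable ℝ a := ha.differentiable (by norm_num)
  have hdφ : Differentiable ℝ φ := hφ.differentiable (by norm_num)
  have hα := heun_boundary_iff (hda α) (hdφ α) haα hφα b τ1 τ2 τ3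
  have hβ := heun_boundary_iff (hda β) (hdφ β) haβ hφβ b τ1 τ2 τ3
  subst hA hB
  rw [← and_assoc, hα, hβ]
  constructor
  · rintro ⟨⟨rfl, h1⟩, -, h2⟩
    have hτ2 : τ2 ≠ 0 := fun h => hτ ⟨h, h⟩
    exact ⟨rfl, h1, mul_left_cancel₀ (mul_ne_zero two_ne_zero hτ2)
      (by linear_combination h2 - h1)⟩
  · rintro ⟨h, h1, h2⟩
    exact ⟨⟨h, h1⟩, h, h2 ▸ h1⟩
end

section
/- Let W, α, β be real numbers and N a natural number, and define the Jacobi operator (Dh)(x) = (1 − x²) h''(x) + (β − α − (α + β + 2)x) h'(x) (so that D = ρ^{−1} d/dx ((1−x²)ρ d/dx) for the weight ρ(x) = (1−x)^α (1+x)^β on (−1, 1)). Then for every twice continuously differentiable f : ℝ → ℝ and every x ∈ ℝ, (1 − x²)(x − W) f''(x) + ((1 − x²) + (x − W)(β − α − (α + β + 2)x)) f'(x) + N(N + α + β + 2) x f(x) = ½ ((D(q·f))(x) + x (Df)(x)) − W (Df)(x) + ((N+1)² + (N + ½)(α + β)) x f(x) + ((α − β)/2) f(x), where q·f denotes the function y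 ↦ y f(y). In other words, the Grünbaum commuting operator for the Jacobi time–band limiting problem equals the algebraic Heun combination ½{D, X} − W D + σ_N X + ((α−β)/2) I with σ_N = (N+1)² + (N+½)(α+β), where X is multiplication by x. -/
theorem hasDerivAt_id_mul {f : ℝ → ℝ} {x : ℝ} (hf : DifferentiableAt ℝ f x) :
    HasDerivAt (fun y => y * f y) (f x + x * deriv f x) x := by
  simpa using (hasDerivAt_id' x).fun_mul hf.hasDerivAt

theorem deriv_deriv_id_mul {f : ℝ → ℝ} (hf : ContDiff ℝ 2 f) (x : ℝ) :
    deriv (deriv fun y => y * f y) x = 2 * deriv f x + x * deriv (deriv f) x := by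
  have hf₀ : Differentiable ℝ f := hf.differentiable (by norm_num)
  have hf₁ : Differentiable ℝ (deriv f) :=
    (hf.deriv' (n := 1)).differentiable (by norm_num)
  have h : (deriv fun y => y * f y) = fun y => f y + y * deriv f y :=
    funext fun y => (hasDerivAt_id_mul (hf₀ y)).deriv
  rw [h, ((hf₀ x).hasDerivAt.fun_add (hasDerivAt_id_mul (hf₁ x))).deriv]
  ring

theorem stmt_15 (W α β : ℝ) (N : ℕ)
    (D : (ℝ → ℝ) → (ℝ → ℝ))
    (hD : ∀ h : ℝ → ℝ, ∀ x : ℝ,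
      D h x = (1 - x ^ 2) * deriv (deriv h) x + (β - α - (α + β + 2) * x) * deriv h x)
    (f : ℝ → ℝ) (hf : ContDiff ℝ 2 f) :
    ∀ x : ℝ,
      (1 - x ^ 2) * (x - W) * deriv (deriv f) x
          + ((1 - x ^ 2) + (x - W) * (β - α - (α + β + 2) * x)) * deriv f x
          + (N : ℝ) * ((N : ℝ) + α + β + 2) * x * f x
      = (1 / 2) * (D (fun y => y * f y) x + x * D f x) - W * D f x
          + (((N : ℝ) + 1) ^ 2 + ((N : ℝ) + 1 / 2) * (α + β)) * x * f x
          + ((α - β) / 2) * f x := by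
  intro x
  have hf₀ : DifferentiableAt ℝ f x := hf.differentiable (by norm_num) x
  rw [hD, hD, deriv_deriv_id_mul hf, (hasDerivAt_id_mul hf₀).deriv]
  ring
end

section
/- Let x_n = (−1)^n (n + ½) for n ∈ ℕ (the anti-Krawtchouk grid), and let N_1 ≥ 1 and N_2 ≥ 1 be integers. Then the system of six linear equations in real unknowns α_1,…,α_6: (i) x_{N_1}² + x_{N_1+2}² + α_1(x_{N_1} + x_{N_1+2}) + α_3 = 0, (ii) x_{N_1−1}² + x_{N_1+1}² + α_1(x_{N_1−1} + x_{N_1+1}) + α_3 = 0, (iii) α_2(x_{N_1}² + x_{N_1+1}²) + α_5 = 0, (iv) x_{N_2}² + x_{N_2+2}² + α_2(x_{N_2} + x_{N_2+2}) + α_4 = 0, (v) x_{N_2−1}² + x_{N_2+1}² + α_2(x_{N_2−1} + x_{N_2+1}) + α_4 = 0, (vi) α_1(x_{N_2}² + x_{N_2+1}²) + α_6 = 0, has a unique solution, given by α_1 = (−1)^{N_1+1}, α_2 = (−1)^{N_2+1}, α_3 = −1 − κ_1, α_4 = −1 − κ_2, α_5 = (−1)^{N_2} κ_1, α_6 = (−1)^{N_1}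 κ_2, where κ_1 = 2N_1² + 4N_1 + 5/2 and κ_2 = 2N_2² + 4N_2 + 5/2. -/
/-- The two equations for one truncation index determine the two coefficients, by subtracting them. -/
lemma antiKrawtchouk_pair_iff {x : ℕ → ℝ}
    (hx : ∀ n : ℕ, x n = (-1 : ℝ) ^ n * ((n : ℝ) + 1 / 2)) {N : ℕ} (hN : 1 ≤ N) (α β : ℝ) :
    (x N ^ 2 + x (N + 2) ^ 2 + α * (x N + x (N + 2)) + β = 0 ∧
      x (N - 1) ^ 2 + x (N + 1) ^ 2 + α * (x (N - 1) + x (N + 1)) + β = 0) ↔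
    (α = (-1 : ℝ) ^ (N + 1) ∧ β = -1 - (2 * (N : ℝ) ^ 2 + 4 * (N : ℝ) + 5 / 2)) := by
  obtain ⟨m, rfl⟩ := Nat.exists_eq_add_of_le' hN
  simp only [hx, Nat.add_sub_cancel, pow_add, pow_one]
  push_cast
  have hm : (0 : ℝ) ≤ m := m.cast_nonneg
  rcases neg_one_pow_eq_or ℝ m with h | h <;> rw [h]
  all_goals
    constructor
    · rintro ⟨h₁, h₂⟩
      refine (and_iff_left_of_imp fun hα => ?_).2
        (mul_left_cancel₀ (by positivity : (m : ℝ) + 2 ≠ 0) ?_)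
      · rw [hα] at h₁
        linarith
      · linarith
    · rintro ⟨rfl, rfl⟩
      constructor <;> ring

/-- Consecutive squares on the grid. -/
lemma antiKrawtchouk_sq_add_sq {x : ℕ → ℝ}
    (hx : ∀ n : ℕ, x n = (-1 : ℝ) ^ n * ((n : ℝ) + 1 / 2)) (N : ℕ) :
    x N ^ 2 + x (N + 1) ^ 2 = 2 * (N : ℝ) ^ 2 + 4 * (N : ℝ) + 5 / 2 := by
  simp only [hx, pow_succ (-1 : ℝ) N]
  push_cast
  rcases neg_one_pow_eq_or ℝ N with h | h <;> rw [h] <;> ring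


theorem stmt_17 (x : ℕ → ℝ)
    (hx : ∀ n : ℕ, x n = (-1 : ℝ) ^ n * ((n : ℝ) + 1 / 2))
    (N₁ N₂ : ℕ) (hN₁ : 1 ≤ N₁) (hN₂ : 1 ≤ N₂)
    (κ₁ κ₂ : ℝ)
    (hκ₁ : κ₁ = 2 * (N₁ : ℝ) ^ 2 + 4 * (N₁ : ℝ) + 5 / 2)
    (hκ₂ : κ₂ = 2 * (N₂ : ℝ) ^ 2 + 4 * (N₂ : ℝ) + 5 / 2) :
    ∀ α₁ α₂ α₃ α₄ α₅ α₆ : ℝ,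
      (x N₁ ^ 2 + x (N₁ + 2) ^ 2 + α₁ * (x N₁ + x (N₁ + 2)) + α₃ = 0 ∧
       x (N₁ - 1) ^ 2 + x (N₁ + 1) ^ 2 + α₁ * (x (N₁ - 1) + x (N₁ + 1)) + α₃ = 0 ∧
       α₂ * (x N₁ ^ 2 + x (N₁ + 1) ^ 2) + α₅ = 0 ∧
       x N₂ ^ 2 + x (N₂ + 2) ^ 2 + α₂ * (x N₂ + x (N₂ + 2)) + α₄ = 0 ∧
       x (N₂ - 1) ^ 2 + x (N₂ + 1) ^ 2 + α₂ * (x (N₂ - 1) + x (N₂ + 1)) + α₄ = 0 ∧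
       α₁ * (x N₂ ^ 2 + x (N₂ + 1) ^ 2) + α₆ = 0)
      ↔
      (α₁ = (-1 : ℝ) ^ (N₁ + 1) ∧ α₂ = (-1 : ℝ) ^ (N₂ + 1) ∧
       α₃ = -1 - κ₁ ∧ α₄ = -1 - κ₂ ∧
       α₅ = (-1 : ℝ) ^ N₂ * κ₁ ∧ α₆ = (-1 : ℝ) ^ N₁ * κ₂) := by
  intro α₁ α₂ α₃ α₄ α₅ α₆
  have h₁ := antiKrawtchouk_pair_iff hx hN₁ α₁ α₃
  have h₂ := antiKrawtchouk_pair_iff hx hN₂ α₂ α₄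
  rw [← hκ₁] at h₁
  rw [← hκ₂] at h₂
  rw [antiKrawtchouk_sq_add_sq hx, antiKrawtchouk_sq_add_sq hx, ← hκ₁, ← hκ₂]
  constructor
  · rintro ⟨e₁, e₂, e₃, e₄, e₅, e₆⟩
    obtain ⟨rfl, rfl⟩ := h₁.1 ⟨e₁, e₂⟩
    obtain ⟨rfl, rfl⟩ := h₂.1 ⟨e₄, e₅⟩
    rw [pow_succ] at e₃ e₆
    exact ⟨rfl, rfl, rfl, rfl, by linarith, by linarith⟩
  · rintro ⟨e₁, e₂, e₃, e₄, rfl, rfl⟩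
    obtain ⟨f₁, f₂⟩ := h₁.2 ⟨e₁, e₃⟩
    obtain ⟨f₄, f₅⟩ := h₂.2 ⟨e₂, e₄⟩
    refine ⟨f₁, f₂, ?_, f₄, f₅, ?_⟩
    · rw [e₂]; ring
    · rw [e₁]; ring
end

section
/- Let N ≥ 2, let a_1,…,a_N, b_0 and x_0,…,x_N be real numbers, and let L_1 be the (N+1)×(N+1) real symmetric tridiagonal matrix with (L_1)_{n,n−1} = (L_1)_{n−1,n} = a_n (1 ≤ n ≤ N), (L_1)_{0,0} = b_0 and (L_1)_{n,n} = 0 for 1 ≤ n ≤ N, and let L_2 be the diagonal matrix with entries x_0,…,x_N. For real numbers α_1,…,α_6 define M = (L_1² L_2² + L_2² L_1²) + α_1(L_1² L_2 + L_2 L_1²) + α_2(L_2² L_1 + L_1 L_2²) + α_3 L_1² + α_4 L_2² + α_5 L_1 + α_6 L_2. Then M is pentadiagonal (M_{ij} = 0 whenever |i − j| ≥ 3), and for all 2 ≤ n ≤ N: M_{n,n−2} = a_n a_{n−1} (x_n² + x_{n−2}² + α_1(x_n + x_{n−2}) + α_3) and M_{n,n−1} = a_n (α_2(x_n² + x_{n−1}²)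 + α_5). -/
/-- Entries of `{T², D²} + α₁ {T², D} + α₂ {T, D²} + α₃ T² + α₄ D² + α₅ T + α₆ D` for a diagonal
matrix `D`. -/
theorem Matrix.anticommutator_combination_diagonal_apply {ι R : Type*} [Fintype ι] [DecidableEq ι]
    [CommRing R] (T : Matrix ι ι R) (d : ι → R) (α₁ α₂ α₃ α₄ α₅ α₆ : R) (i j : ι) :
    ((T ^ 2 * Matrix.diagonal d ^ 2 + Matrix.diagonal d ^ 2 * T ^ 2)
      + α₁ • (T ^ 2 * Matrix.diagonal d + Matrix.diagonal d * T ^ 2)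
      + α₂ • (Matrix.diagonal d ^ 2 * T + T * Matrix.diagonal d ^ 2)
      + α₃ • T ^ 2 + α₄ • Matrix.diagonal d ^ 2 + α₅ • T + α₆ • Matrix.diagonal d) i j =
    (T ^ 2) i j * (d i ^ 2 + d j ^ 2 + α₁ * (d i + d j) + α₃)
      + T i j * (α₂ * (d i ^ 2 + d j ^ 2) + α₅)
      + (if i = j then α₄ * d i ^ 2 + α₆ * d i else 0) := by
  rw [Matrix.diagonal_pow]
  simp only [Matrix.add_apply, Matrix.smul_apply, Matrix.mul_diagonal, Matrix.diagonal_mul,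
    Matrix.diagonal_apply, smul_eq_mul, Pi.pow_apply]
  split_ifs <;> ring

theorem stmt_18 (N : ℕ) (hN : 2 ≤ N) (a x : ℕ → ℝ) (b₀ : ℝ)
    (α₁ α₂ α₃ α₄ α₅ α₆ : ℝ)
    (L₁ L₂ M : Matrix (Fin (N + 1)) (Fin (N + 1)) ℝ)
    (hL₁ : L₁ = Matrix.of fun i j : Fin (N + 1) =>
      if i = j then (if (i : ℕ) = 0 then b₀ else 0)
      else if (i : ℕ) = (j : ℕ) + 1 then a (i : ℕ)
      else if (j : ℕ) = (i : ℕ) + 1 then a (j : ℕ)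
      else 0)
    (hL₂ : L₂ = Matrix.of fun i j : Fin (N + 1) => if i = j then x (i : ℕ) else 0)
    (hM : M = (L₁ ^ 2 * L₂ ^ 2 + L₂ ^ 2 * L₁ ^ 2)
      + α₁ • (L₁ ^ 2 * L₂ + L₂ * L₁ ^ 2) + α₂ • (L₂ ^ 2 * L₁ + L₁ * L₂ ^ 2)
      + α₃ • L₁ ^ 2 + α₄ • L₂ ^ 2 + α₅ • L₁ + α₆ • L₂) :
    (∀ i j : Fin (N + 1), ((i : ℕ) + 3 ≤ (j : ℕ) ∨ (j : ℕ) + 3 ≤ (i : ℕ)) → M i j = 0) ∧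
    (∀ n : ℕ, ∀ _ : 2 ≤ n, ∀ _ : n ≤ N,
      M ⟨n, by omega⟩ ⟨n - 2, by omega⟩ =
        a n * a (n - 1) * (x n ^ 2 + x (n - 2) ^ 2 + α₁ * (x n + x (n - 2)) + α₃) ∧
      M ⟨n, by omega⟩ ⟨n - 1, by omega⟩ =
        a n * (α₂ * (x n ^ 2 + x (n - 1) ^ 2) + α₅)) := by
  have hD : L₂ = Matrix.diagonal fun i : Fin (N + 1) => x i := by
    rw [hL₂]; rfl
  have entry (i j : Fin (N + 1)) := congrFun (congrFun hM i) j
  simp only [hD, Matrix.anticommutator_combination_diagonal_apply] at entry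
  have far (i j : Fin (N + 1)) (h : (i : ℕ) + 2 ≤ j ∨ (j : ℕ) + 2 ≤ i) : L₁ i j = 0 := by
    rw [hL₁, Matrix.of_apply, if_neg (by omega), if_neg (by omega), if_neg (by omega)]
  have diag (i j : Fin (N + 1)) (hij : (i : ℕ) = j) (h : (i : ℕ) ≠ 0) : L₁ i j = 0 := by
    rw [hL₁, Matrix.of_apply, if_pos (Fin.ext hij), if_neg h]
  have sub (i j : Fin (N + 1)) (h : (i : ℕ) = j + 1) : L₁ i j = a i := by
    rw [hL₁, Matrix.of_apply, if_neg (by omega), if_pos h]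
  refine ⟨fun i j hij => ?_, fun n hn hnN => ⟨?_, ?_⟩⟩
  · have hsq : (L₁ ^ 2) i j = 0 := by
      rw [pow_two, Matrix.mul_apply]
      refine Finset.sum_eq_zero fun k _ => ?_
      by_cases hk : (i : ℕ) + 2 ≤ k ∨ (k : ℕ) + 2 ≤ i
      · rw [far i k hk, zero_mul]
      · rw [far k j (by omega), mul_zero]
    rw [entry, hsq, far i j (by omega), if_neg (by omega)]
    ring
  · have hsq : (L₁ ^ 2) ⟨n, by omega⟩ ⟨n - 2, by omega⟩ = a n * a (n - 1) := by
      rw [pow_two, Matrix.mul_apply, Finset.sum_eq_single ⟨n - 1, by omega⟩]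
      · rw [sub _ _ (by simp only; omega), sub _ _ (by simp only; omega)]
      · intro k _ hk
        have hk' : (k : ℕ) ≠ n - 1 := fun h => hk (Fin.ext h)
        by_cases hlt : (k : ℕ) + 2 ≤ n
        · rw [far _ k (Or.inr hlt), zero_mul]
        · rw [far k _ (by simp only; omega), mul_zero]
      · simp
    rw [entry, hsq, far _ _ (by simp only; omega), if_neg (by simp only [Fin.mk.injEq]; omega)]
    ring
  · have hsq : (L₁ ^ 2) ⟨n, by omega⟩ ⟨n - 1, by omega⟩ = 0 := by
      rw [pow_two, Matrix.mul_apply]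
      refine Finset.sum_eq_zero fun k _ => ?_
      by_cases hk : (k : ℕ) = n
      · rw [diag _ k hk.symm (by simp only; omega), zero_mul]
      by_cases hk₁ : (k : ℕ) = n - 1
      · rw [diag k _ hk₁ (by omega), mul_zero]
      by_cases hlt : (k : ℕ) + 2 ≤ n
      · rw [far _ k (Or.inr hlt), zero_mul]
      · rw [far k _ (by simp only; omega), mul_zero]
    rw [entry, hsq, sub _ _ (by simp only; omega), if_neg (by simp only [Fin.mk.injEq]; omega)]
    ring
end

section
/- Let N ≥ 3 be an integer, and define the (N+1)×(N+1) real matrices L_1 and L_2 by: L_1 symmetric tridiagonal with (L_1)_{n,n−1} = (L_1)_{n−1,n} = a_n where a_n = √((N+1)² − n²)/2 for 1 ≤ n ≤ N, (L_1)_{0,0} = (−1)^N (N+1)/2 and (L_1)_{n,n} = 0 for 1 ≤ n ≤ N; and L_2 diagonal with entries x_n = (−1)^n (n + ½), 0 ≤ n ≤ N. Fix integers N_1 and N_2 with 1 ≤ N_1 ≤ N − 2 and N_2 ≥ 1, set κ_1 = 2N_1² + 4N_1 + 5/2 and κ_2 = 2N_2² + 4N_2 + 5/2, and define M = (L_1²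 L_2² + L_2² L_1²) + (−1)^{N_1+1}(L_1² L_2 + L_2 L_1²) + (−1)^{N_2+1}(L_2² L_1 + L_1 L_2²) + (−1 − κ_1) L_1² + (−1 − κ_2) L_2² + (−1)^{N_2} κ_1 L_1 + (−1)^{N_1} κ_2 L_2. Then M commutes with the projection π_{N_1}: M π_{N_1} = π_{N_1} M, where π_{N_1} is the diagonal matrix with (π_{N_1})_{ii} = 1 for i ≤ N_1 and 0 otherwise. -/
/-- A matrix without entries linking `{i ≤ J}` to its complement commutes with `projMat N J`. -/
lemma mul_projMat_comm {N J : ℕ} (M : Matrix (Fin (N + 1)) (Fin (N + 1)) ℝ)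
    (h : ∀ i j : Fin (N + 1), (i : ℕ) ≤ J → J < (j : ℕ) → M i j = 0 ∧ M j i = 0) :
    M * projMat N J = projMat N J * M := by
  have hp : projMat N J =
      Matrix.diagonal fun i : Fin (N + 1) => if (i : ℕ) ≤ J then (1 : ℝ) else 0 := by
    ext i j
    by_cases hij : i = j <;> simp [projMat, hij]
  rw [hp]
  ext i j
  rw [Matrix.mul_diagonal, Matrix.diagonal_mul]
  by_cases hi : (i : ℕ) ≤ J <;> by_cases hj : (j : ℕ) ≤ J
  · simp [hi, hj]
  · simp [hi, hj, (h i j hi (not_le.mp hj)).1]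
  · simp [hi, hj, (h j i hj (not_le.mp hi)).2]
  · simp [hi, hj]

/-- The square of a tridiagonal matrix is pentadiagonal. -/
lemma sq_apply_eq_zero_of_tridiagonal {n : ℕ} (A : Matrix (Fin n) (Fin n) ℝ)
    (hA : ∀ i j : Fin n, (i : ℕ) + 1 < j ∨ (j : ℕ) + 1 < i → A i j = 0)
    (i j : Fin n) (hij : (i : ℕ) + 2 < j ∨ (j : ℕ) + 2 < i) : (A ^ 2) i j = 0 := by
  rw [sq, Matrix.mul_apply]
  refine Finset.sum_eq_zero fun k _ => ?_
  by_cases hk : (i : ℕ) + 1 < k ∨ (k : ℕ) + 1 < i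
  · rw [hA i k hk, zero_mul]
  · rw [hA k j (by omega), mul_zero]

/-- Off-diagonal entries of the quadratic ansatz with a diagonal second operator. -/
lemma quadratic_ansatz_apply {n : ℕ} (A : Matrix (Fin n) (Fin n) ℝ) (d : Fin n → ℝ)
    (s t u v p q : ℝ) (i j : Fin n) (hij : i ≠ j) :
    ((A ^ 2 * Matrix.diagonal d ^ 2 + Matrix.diagonal d ^ 2 * A ^ 2)
      + s • (A ^ 2 * Matrix.diagonal d + Matrix.diagonal d * A ^ 2)
      + t • (Matrix.diagonal d ^ 2 * A + A * Matrix.diagonal d ^ 2)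
      + u • A ^ 2 + v • Matrix.diagonal d ^ 2 + p • A + q • Matrix.diagonal d) i j
      = (d i ^ 2 + d j ^ 2 + s * (d i + d j) + u) * (A ^ 2) i j
        + (t * (d i ^ 2 + d j ^ 2) + p) * A i j := by
  simp only [Matrix.diagonal_pow, Matrix.add_apply, Matrix.smul_apply, Matrix.mul_diagonal,
    Matrix.diagonal_mul, Matrix.diagonal_apply_ne _ hij, Pi.pow_apply, smul_eq_mul]
  ring

theorem stmt_19 (N : ℕ) (hN : 3 ≤ N)
    (a x : ℕ → ℝ)
    (ha : ∀ n : ℕ, a n = Real.sqrt (((N : ℝ) + 1) ^ 2 - (n : ℝ) ^ 2) / 2)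
    (hx : ∀ n : ℕ, x n = (-1 : ℝ) ^ n * ((n : ℝ) + 1 / 2))
    (L₁ L₂ : Matrix (Fin (N + 1)) (Fin (N + 1)) ℝ)
    (hL₁ : L₁ = Matrix.of fun i j : Fin (N + 1) =>
      if i = j then (if (i : ℕ) = 0 then (-1 : ℝ) ^ N * ((N : ℝ) + 1) / 2 else 0)
      else if (i : ℕ) = (j : ℕ) + 1 then a (i : ℕ)
      else if (j : ℕ) = (i : ℕ) + 1 then a (j : ℕ)
      else 0)
    (hL₂ : L₂ = Matrix.of fun i j : Fin (N + 1) => if i = j then x (i : ℕ) else 0)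
    (N₁ N₂ : ℕ) (hN₁ : 1 ≤ N₁) (hN₁' : N₁ ≤ N - 2) (hN₂ : 1 ≤ N₂)
    (κ₁ κ₂ : ℝ)
    (hκ₁ : κ₁ = 2 * (N₁ : ℝ) ^ 2 + 4 * (N₁ : ℝ) + 5 / 2)
    (hκ₂ : κ₂ = 2 * (N₂ : ℝ) ^ 2 + 4 * (N₂ : ℝ) + 5 / 2)
    (M : Matrix (Fin (N + 1)) (Fin (N + 1)) ℝ)
    (hM : M = (L₁ ^ 2 * L₂ ^ 2 + L₂ ^ 2 * L₁ ^ 2)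
      + ((-1 : ℝ) ^ (N₁ + 1)) • (L₁ ^ 2 * L₂ + L₂ * L₁ ^ 2)
      + ((-1 : ℝ) ^ (N₂ + 1)) • (L₂ ^ 2 * L₁ + L₁ * L₂ ^ 2)
      + (-1 - κ₁) • L₁ ^ 2 + (-1 - κ₂) • L₂ ^ 2
      + ((-1 : ℝ) ^ N₂ * κ₁) • L₁ + ((-1 : ℝ) ^ N₁ * κ₂) • L₂) :
    M * projMat N N₁ = projMat N N₁ * M := by
  have hd : L₂ = Matrix.diagonal fun i : Fin (N + 1) => x i := by
    ext i j
    by_cases hij : i = j <;> simp [hL₂, hij]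
  have hA : ∀ i j : Fin (N + 1), (i : ℕ) + 1 < j ∨ (j : ℕ) + 1 < i → L₁ i j = 0 := by
    intro i j hij
    have hne : i ≠ j := by rintro rfl; omega
    rw [hL₁, Matrix.of_apply, if_neg hne, if_neg (by omega), if_neg (by omega)]
  have hs : ((-1 : ℝ) ^ N₁) * (-1) ^ N₁ = 1 := by
    rw [← mul_pow]; norm_num
  have hadj : x N₁ ^ 2 + x (N₁ + 1) ^ 2 = κ₁ := by
    rw [hx, hx, hκ₁, pow_succ]
    push_cast
    linear_combination (((N₁ : ℝ) + 1 / 2) ^ 2 + ((N₁ : ℝ) + 3 / 2) ^ 2) * hs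
  have hcoef : ∀ i j : ℕ, i ≤ N₁ → N₁ < j → j ≤ i + 2 →
      x i ^ 2 + x j ^ 2 + (-1 : ℝ) ^ (N₁ + 1) * (x i + x j) + (-1 - κ₁) = 0 := by
    intro i j hi hj hij
    obtain ⟨rfl, rfl⟩ | ⟨rfl, rfl⟩ | ⟨rfl, rfl⟩ :
        (i = N₁ ∧ j = N₁ + 1) ∨ (i = N₁ ∧ j = N₁ + 2) ∨ (N₁ = i + 1 ∧ j = i + 2) := by omega
    all_goals
      rw [hκ₁, hx, hx]
      simp only [pow_succ] at hs ⊢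
      push_cast
    · linear_combination (((i : ℝ) + 1 / 2) ^ 2 + ((i : ℝ) + 3 / 2) ^ 2 + 1) * hs
    · linear_combination (((i : ℝ) + 1 / 2) ^ 2 + ((i : ℝ) + 5 / 2) ^ 2 - (2 * i + 3)) * hs
    · linear_combination (((i : ℝ) + 1 / 2) ^ 2 + ((i : ℝ) + 5 / 2) ^ 2 + (2 * i + 3)) * hs
  have hsq := sq_apply_eq_zero_of_tridiagonal L₁ hA
  have hterm : ∀ i j : Fin (N + 1), (i : ℕ) ≤ N₁ → N₁ < (j : ℕ) →
      (x i ^ 2 + x j ^ 2 + (-1 : ℝ) ^ (N₁ + 1) * (x i + x j) + (-1 - κ₁) = 0 ∨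
        ((L₁ ^ 2) i j = 0 ∧ (L₁ ^ 2) j i = 0)) ∧
      ((-1 : ℝ) ^ (N₂ + 1) * (x i ^ 2 + x j ^ 2) + (-1) ^ N₂ * κ₁ = 0 ∨
        (L₁ i j = 0 ∧ L₁ j i = 0)) := by
    intro i j hi hj
    constructor
    · by_cases hij : (j : ℕ) ≤ i + 2
      · exact Or.inl (hcoef i j hi hj hij)
      · exact Or.inr ⟨hsq i j (by omega), hsq j i (by omega)⟩
    · by_cases hij : (j : ℕ) ≤ i + 1
      · left
        rw [show (i : ℕ) = N₁ by omega, show (j : ℕ) = N₁ + 1 by omega, hadj]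
        ring
      · exact Or.inr ⟨hA i j (by omega), hA j i (by omega)⟩
  refine mul_projMat_comm M fun i j hi hj => ?_
  have hne : i ≠ j := by rintro rfl; omega
  obtain ⟨h₁, h₂⟩ := hterm i j hi hj
  rw [hM, hd, quadratic_ansatz_apply _ _ _ _ _ _ _ _ i j hne,
    quadratic_ansatz_apply _ _ _ _ _ _ _ _ j i hne.symm, add_comm (x j ^ 2), add_comm (x j)]
  constructor
  · rcases h₁ with h₁ | ⟨h₁, -⟩ <;> rcases h₂ with h₂ | ⟨h₂, -⟩ <;> rw [h₁, h₂] <;> simp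
  · rcases h₁ with h₁ | ⟨-, h₁⟩ <;> rcases h₂ with h₂ | ⟨-, h₂⟩ <;> rw [h₁, h₂] <;> simp
end
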